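/- arXiv:1506.08418 — 3 statements merged into one kernel-verified Lean document; each statement's English description precedes it below -/
import Mathlib

section
/- Let a₁, a₂, a₃ denote the images in D(2) of (s,1), (sr,1), (1,s) respectively, and let c denote the image of (r²,1). Then the subgroup M = ⟨a₁, a₂, c, a₃⟩ of D(2) has index 2 and is isomorphic to D₈ × ℤ/2. -/
open DihedralGroup

abbrev D8 : Type := DihedralGroup 4

def Zc : Subgroup (D8 × D8) :=
  Subgroup.zpowers ((DihedralGroup.r 2, DihedralGroup.r 2) : D8 × D8)

lemma Zc_le_center : Zc ≤ Subgroup.center (D8 × D8) := by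
  rw [Zc, Subgroup.zpowers_le]
  exact Subgroup.mem_center_iff.mpr (by decide)

instance : Zc.Normal := ⟨by
  intro n hn g
  have h := Subgroup.mem_center_iff.mp (Zc_le_center hn) g
  have : g * n * g⁻¹ = n := by
    rw [h]; group
  rwa [this]⟩

/-- `D(2) = 2₊^{1+4}`, the central product `D₈ ∘ D₈`. -/
abbrev DTwo : Type := (D8 × D8) ⧸ Zc

def π : D8 × D8 →* DTwo := QuotientGroup.mk' Zc

lemma mem_Zc_iff (x : D8 × D8) : x ∈ Zc ↔ x = 1 ∨ x = (r 2, r 2) := by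
  constructor
  · rintro ⟨k, rfl⟩
    have hsq : ((r 2, r 2) : D8 × D8) ^ (2 : ℤ) = 1 := by decide
    obtain ⟨m, rfl | rfl⟩ := Int.even_or_odd' k
    · left
      simp only [zpow_mul, hsq, one_zpow]
    · right
      simp only [zpow_add, zpow_mul, hsq, one_zpow, one_mul, zpow_one]
  · rintro (rfl | rfl)
    · exact one_mem _
    · exact Subgroup.mem_zpowers _

lemma card_Zc : Nat.card Zc = 2 := by
  rw [Zc, Nat.card_zpowers]
  exact orderOf_eq_prime (by decide) (by decide)

lemma card_DTwo : Nat.card DTwo = 32 := by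
  have h := Subgroup.card_eq_card_quotient_mul_card_subgroup Zc
  rw [card_Zc, Nat.card_prod, DihedralGroup.nat_card] at h
  change 2 * 4 * (2 * 4) = Nat.card DTwo * 2 at h
  lia

/-- The embedding of `ℤ/2` in `D₈` sending the generator to the reflection `s`. -/
def reflectionHom : Multiplicative (ZMod 2) →* D8 where
  toFun z := if z = 1 then 1 else sr 0
  map_one' := rfl
  map_mul' := by decide

/-- The homomorphism `D₈ × ℤ/2 → D(2)` which is `x ↦ (x, 1)` on the first factor and sends the
generator of the second factor to the image of `(1, s)`. -/
def prodToDTwo : DihedralGroup 4 × Multiplicative (ZMod 2) →* DTwo :=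
  π.comp ((MonoidHom.id D8).prodMap reflectionHom)

lemma prodToDTwo_apply (x : DihedralGroup 4) (z : Multiplicative (ZMod 2)) :
    prodToDTwo (x, z) = π (x, reflectionHom z) := rfl

lemma prodToDTwo_injective : Function.Injective prodToDTwo := by
  rw [injective_iff_map_eq_one]
  rintro ⟨x, z⟩ h
  rw [prodToDTwo_apply, π, QuotientGroup.mk'_apply, QuotientGroup.eq_one_iff, mem_Zc_iff] at h
  revert x z
  decide

lemma closure_sr_zero_sr_one :
    Subgroup.closure {sr 0, sr 1} = (⊤ : Subgroup (DihedralGroup 4)) := by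
  rw [eq_top_iff]
  have h0 : sr 0 ∈ Subgroup.closure {sr 0, (sr 1 : DihedralGroup 4)} :=
    Subgroup.subset_closure (by simp)
  have h1 : sr 1 ∈ Subgroup.closure {sr 0, (sr 1 : DihedralGroup 4)} :=
    Subgroup.subset_closure (by simp)
  have hr (i : ZMod 4) : r i ∈ Subgroup.closure {sr 0, (sr 1 : DihedralGroup 4)} := by
    have h : r i = (sr 0 * sr 1 : DihedralGroup 4) ^ i.val := by
      revert i
      decide
    exact h ▸ pow_mem (mul_mem h0 h1) _
  rintro (i | i) -
  · exact hr i
  · simpa using mul_mem h0 (hr i)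

lemma range_prodToDTwo :
    prodToDTwo.range = Subgroup.closure {π (sr 0, 1), π (sr 1, 1), π (r 2, 1), π (1, sr 0)} := by
  apply le_antisymm
  · rintro _ ⟨⟨x, z⟩, rfl⟩
    have hsplit : prodToDTwo (x, z) = π (x, 1) * π (1, reflectionHom z) := by
      rw [prodToDTwo_apply, ← map_mul, Prod.mk_mul_mk, mul_one, one_mul]
    rw [hsplit]
    refine mul_mem ?_ ?_
    · have hle : Subgroup.closure {sr 0, sr 1} ≤ Subgroup.comap (π.comp (MonoidHom.inl D8 D8))
          (Subgroup.closure {π (sr 0, 1), π (sr 1, 1), π (r 2, 1), π (1, sr 0)}) := by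
        rw [Subgroup.closure_le]
        rintro _ (rfl | rfl) <;> exact Subgroup.subset_closure (by simp)
      exact hle (closure_sr_zero_sr_one ▸ Subgroup.mem_top x)
    · by_cases hz : z = 1
      · subst hz
        rw [map_one, ← Prod.one_eq_mk, map_one]
        exact one_mem _
      · have h : reflectionHom z = sr 0 := if_neg hz
        rw [h]
        exact Subgroup.subset_closure (by simp)
  · rw [Subgroup.closure_le]
    rintro _ (rfl | rfl | rfl | rfl)
    · exact ⟨(sr 0, 1), rfl⟩
    · exact ⟨(sr 1, 1), rfl⟩
    · exact ⟨(r 2, 1), rfl⟩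
    · exact ⟨(1, Multiplicative.ofAdd 1), rfl⟩

/-- The subgroup `M = ⟨a₁, a₂, c, a₃⟩` of `D(2)` has index `2` and is isomorphic to
`D₈ × ℤ/2`, where `a₁, a₂, c, a₃` are the images of `(s,1), (sr,1), (r²,1), (1,s)`. -/
theorem stmt4 :
    (Subgroup.closure {π (DihedralGroup.sr 0, 1), π (DihedralGroup.sr 1, 1),
        π (DihedralGroup.r 2, 1), π (1, DihedralGroup.sr 0)} : Subgroup DTwo).index = 2 ∧
    Nonempty ((Subgroup.closure {π (DihedralGroup.sr 0, 1), π (DihedralGroup.sr 1, 1),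
        π (DihedralGroup.r 2, 1), π (1, DihedralGroup.sr 0)} : Subgroup DTwo) ≃*
      (DihedralGroup 4 × Multiplicative (ZMod 2))) := by
  rw [← range_prodToDTwo]
  have e := MonoidHom.ofInjective prodToDTwo_injective
  refine ⟨?_, ⟨e.symm⟩⟩
  have hcard : Nat.card prodToDTwo.range = 16 := by
    rw [← Nat.card_congr e.toEquiv, Nat.card_prod, DihedralGroup.nat_card]
    simp
  have h := prodToDTwo.range.card_mul_index
  rw [hcard, card_DTwo] at h
  lia
end

section
/- Let c, a₁, a₃ denote the images in D(2) of (r²,1), (s,1), (1,s) respectively, and let H = ⟨c, a₁, a₃⟩. Then H is an elementary abelian subgroup of order 8 (H is commutative and every element of H squares to the identity), and the centralizer of H in D(2) equals H. -/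
open DihedralGroup

lemma π_eq_iff (x y : D8 × D8) : π x = π y ↔ x⁻¹ * y = 1 ∨ x⁻¹ * y = (r 2, r 2) := by
  rw [← mem_Zc_iff]
  exact QuotientGroup.eq

lemma π_surjective : Function.Surjective π := QuotientGroup.mk'_surjective Zc

/-- The lift `(r²)^i s^j, s^k` of the element `c^i a₁^j a₃^k` of `D(2)`. -/
def liftWord (p : Fin 2 × Fin 2 × Fin 2) : D8 × D8 :=
  (r 2, 1) ^ (p.1 : ℕ) * (sr 0, 1) ^ (p.2.1 : ℕ) * (1, sr 0) ^ (p.2.2 : ℕ)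

lemma π_liftWord_injective : Function.Injective fun p => π (liftWord p) := by
  intro p q h
  have key : ∀ p q : Fin 2 × Fin 2 × Fin 2, (liftWord p)⁻¹ * liftWord q = 1 ∨
      (liftWord p)⁻¹ * liftWord q = (r 2, r 2) → p = q := by decide
  exact key p q ((π_eq_iff _ _).mp h)

lemma π_liftWord_mul_self (p : Fin 2 × Fin 2 × Fin 2) :
    π (liftWord p) * π (liftWord p) = 1 := by
  have key : ∀ p : Fin 2 × Fin 2 × Fin 2, liftWord p * liftWord p = 1 := by decide
  rw [← map_mul, key, map_one]

/-- The subgroup `⟨c, a₁, a₃⟩` of `D(2)`. -/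
abbrev elemAb : Subgroup DTwo :=
  Subgroup.closure {π (r 2, 1), π (sr 0, 1), π (1, sr 0)}

lemma π_liftWord_mem (p : Fin 2 × Fin 2 × Fin 2) : π (liftWord p) ∈ elemAb := by
  simp only [liftWord, map_mul, map_pow]
  refine mul_mem (mul_mem ?_ ?_) ?_ <;>
    exact pow_mem (Subgroup.subset_closure (by simp)) _

lemma elemAb_le_centralizer : elemAb ≤ Subgroup.centralizer (elemAb : Set DTwo) := by
  refine (Subgroup.closure_le _).mpr fun x hx => ?_
  have h : elemAb ≤ Subgroup.centralizer {x} := by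
    refine (Subgroup.closure_le _).mpr fun y hy => ?_
    rw [SetLike.mem_coe, Subgroup.mem_centralizer_singleton_iff]
    rcases hx with rfl | rfl | rfl <;> rcases hy with rfl | rfl | rfl <;>
      simp only [← map_mul] <;> exact congrArg π (by decide)
  exact fun y hy => (Subgroup.mem_centralizer_singleton_iff.mp (h hy))

lemma exists_liftWord_of_mem_centralizer {x : DTwo}
    (hx : x ∈ Subgroup.centralizer (elemAb : Set DTwo)) : ∃ p, π (liftWord p) = x := by
  obtain ⟨g, rfl⟩ := π_surjective x
  have key : ∀ g : D8 × D8,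
      (((sr 0, 1) * g)⁻¹ * (g * (sr 0, 1)) = 1 ∨
        ((sr 0, 1) * g)⁻¹ * (g * (sr 0, 1)) = (r 2, r 2)) →
      (((1, sr 0) * g)⁻¹ * (g * (1, sr 0)) = 1 ∨
        ((1, sr 0) * g)⁻¹ * (g * (1, sr 0)) = (r 2, r 2)) →
      ∃ p, (liftWord p)⁻¹ * g = 1 ∨ (liftWord p)⁻¹ * g = (r 2, r 2) := by
    decide +kernel
  have h₁ := hx (π (sr 0, 1)) (Subgroup.subset_closure (by simp))
  have h₂ := hx (π (1, sr 0)) (Subgroup.subset_closure (by simp))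
  simp only [← map_mul, π_eq_iff] at h₁ h₂
  simpa only [π_eq_iff] using key g h₁ h₂

lemma coe_elemAb : (elemAb : Set DTwo) = Set.range fun p => π (liftWord p) := by
  refine Set.Subset.antisymm
    (fun x hx => exists_liftWord_of_mem_centralizer (elemAb_le_centralizer hx)) ?_
  rintro _ ⟨p, rfl⟩
  exact π_liftWord_mem p

/-- `H = ⟨c, a₁, a₃⟩` is elementary abelian of order `8` and is self-centralizing
in `D(2)`. -/
theorem stmt6 :
    Nat.card (Subgroup.closure {π (DihedralGroup.r 2, 1), π (DihedralGroup.sr 0, 1),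
        π (1, DihedralGroup.sr 0)} : Subgroup DTwo) = 8 ∧
    (∀ x y : (Subgroup.closure {π (DihedralGroup.r 2, 1), π (DihedralGroup.sr 0, 1),
        π (1, DihedralGroup.sr 0)} : Subgroup DTwo), x * y = y * x) ∧
    (∀ x : (Subgroup.closure {π (DihedralGroup.r 2, 1), π (DihedralGroup.sr 0, 1),
        π (1, DihedralGroup.sr 0)} : Subgroup DTwo), x * x = 1) ∧
    Subgroup.centralizer ((Subgroup.closure {π (DihedralGroup.r 2, 1),
        π (DihedralGroup.sr 0, 1), π (1, DihedralGroup.sr 0)} : Subgroup DTwo) : Set DTwo) =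
      Subgroup.closure {π (DihedralGroup.r 2, 1), π (DihedralGroup.sr 0, 1),
        π (1, DihedralGroup.sr 0)} := by
  refine ⟨?_, fun x y => ?_, fun x => ?_, le_antisymm (fun x hx => ?_) elemAb_le_centralizer⟩
  · change Nat.card (elemAb : Set DTwo) = 8
    rw [coe_elemAb, Nat.card_range_of_injective π_liftWord_injective]
    simp
  · exact Subtype.ext (elemAb_le_centralizer y.2 x x.2)
  · obtain ⟨p, hp⟩ := exists_liftWord_of_mem_centralizer (elemAb_le_centralizer x.2)
    refine Subtype.ext ?_
    rw [Subgroup.coe_mul, ← hp, π_liftWord_mul_self, Subgroup.coe_one]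
  · obtain ⟨p, rfl⟩ := exists_liftWord_of_mem_centralizer hx
    exact π_liftWord_mem p
end

section
/- The commutative ring R = (ℤ/2)[x₁, x₂, x₃, x₄, w]/(q₀, q₁), where q₀ = x₁x₂ + x₃x₄ and q₁ = x₁²x₂ + x₁x₂² + x₃²x₄ + x₃x₄², is reduced: it has no nonzero nilpotent elements. -/
open MvPolynomial

/-- `q₀ = x₁x₂ + x₃x₄` in `(ℤ/2)[x₁, x₂, x₃, x₄, w]`, with variables
`x₁, x₂, x₃, x₄, w` encoded as `X 0, X 1, X 2, X 3, X 4`. -/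
noncomputable def q0 : MvPolynomial (Fin 5) (ZMod 2) := X 0 * X 1 + X 2 * X 3

/-- `q₁ = x₁²x₂ + x₁x₂² + x₃²x₄ + x₃x₄²`. -/
noncomputable def q1 : MvPolynomial (Fin 5) (ZMod 2) :=
  X 0 ^ 2 * X 1 + X 0 * X 1 ^ 2 + X 2 ^ 2 * X 3 + X 2 * X 3 ^ 2

/-- The ring `R = (ℤ/2)[x₁, x₂, x₃, x₄, w]/(q₀, q₁)`. -/
noncomputable def Rring := MvPolynomial (Fin 5) (ZMod 2) ⧸ Ideal.span {q0, q1}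

noncomputable instance : CommRing Rring := Ideal.Quotient.commRing _

namespace Ideal

variable {A : Type*} [CommRing A]

/-- If `x` is a nonzerodivisor modulo `(z, y)`, then `(z, xy) = (z, x) ∩ (z, y)`. -/
theorem span_pair_mul_eq_inf {x y z : A}
    (h : ∀ b, b * x ∈ span {z, y} → b ∈ span {z, y}) :
    span {z, x * y} = span {z, x} ⊓ span {z, y} := by
  refine le_antisymm (le_inf ?_ ?_) fun f ⟨hx, hy⟩ => ?_
  · rw [span_le, Set.pair_subset_iff]
    exact ⟨mem_span_pair.2 ⟨1, 0, by ring⟩, mem_span_pair.2 ⟨0, y, by ring⟩⟩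
  · rw [span_le, Set.pair_subset_iff]
    exact ⟨mem_span_pair.2 ⟨1, 0, by ring⟩, mem_span_pair.2 ⟨0, x, by ring⟩⟩
  · obtain ⟨a, b, rfl⟩ := mem_span_pair.1 hx
    have hz : a * z ∈ span {z, y} := mem_span_pair.2 ⟨a, 0, by ring⟩
    obtain ⟨c, d, rfl⟩ := mem_span_pair.1 (h b ((Ideal.add_mem_iff_right _ hz).1 hy))
    exact mem_span_pair.2 ⟨a + c * x, d, by ring⟩

theorem mem_inf_of_mul_mem_inf {I J : Ideal A} {x : A}
    (hI : ∀ b, b * x ∈ I → b ∈ I) (hJ : ∀ b, b * x ∈ J → b ∈ J) :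
    ∀ b, b * x ∈ I ⊓ J → b ∈ I ⊓ J :=
  fun b hb => ⟨hI b hb.1, hJ b hb.2⟩

/-- An element `x` is a nonzerodivisor modulo a prime `(u, v)` if some ring homomorphism kills
`u` and `v` but not `x`. -/
theorem IsPrime.mem_span_pair_of_mul_mem {B : Type*} [CommRing B] {u v x : A}
    (hP : (span {u, v}).IsPrime) (f : A →+* B) (hu : f u = 0) (hv : f v = 0) (hx : f x ≠ 0) :
    ∀ b, b * x ∈ span {u, v} → b ∈ span {u, v} := by
  refine fun b hb => (hP.mem_or_mem hb).resolve_right fun h => hx ?_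
  obtain ⟨c, d, rfl⟩ := mem_span_pair.1 h
  simp [hu, hv]

end Ideal

namespace MvPolynomial

/-- An ideal `(u, v)` that is killed by a substitution `φ` which is the identity modulo `(u, v)`
is the kernel of this substitution, hence prime. -/
theorem isPrime_span_pair_of_aeval {σ K : Type*} [CommRing K] [IsDomain K]
    {u v : MvPolynomial σ K} (φ : σ → MvPolynomial σ K)
    (hu : aeval φ u = 0) (hv : aeval φ v = 0) (hφ : ∀ i, X i - φ i ∈ Ideal.span {u, v}) :
    (Ideal.span {u, v}).IsPrime := by
  have hker : Ideal.span {u, v} = RingHom.ker (aeval φ : MvPolynomial σ K →ₐ[K] _) := by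
    refine le_antisymm ?_ fun f hf => ?_
    · rw [Ideal.span_le, Set.pair_subset_iff]
      exact ⟨hu, hv⟩
    · have hcomp : Ideal.Quotient.mkₐ K (Ideal.span {u, v}) =
          (Ideal.Quotient.mkₐ K (Ideal.span {u, v})).comp (aeval φ) := by
        ext i
        simpa using Ideal.Quotient.eq.2 (hφ i)
      have := DFunLike.congr_fun hcomp f
      rw [AlgHom.comp_apply, (RingHom.mem_ker).1 hf, map_zero] at this
      exact Ideal.Quotient.eq_zero_iff_mem.1 this
  rw [hker]
  exact RingHom.ker_isPrime _

theorem isPrime_span_pair_X {σ K : Type*} [CommRing K] [IsDomain K] (i j : σ) :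
    (Ideal.span {X i, X j} : Ideal (MvPolynomial σ K)).IsPrime := by
  classical
  refine isPrime_span_pair_of_aeval (fun k => if k = i ∨ k = j then 0 else X k)
    (by simp) (by simp) fun k => ?_
  by_cases hk : k = i ∨ k = j
  · simp only [hk, if_true, sub_zero]
    exact Ideal.subset_span (hk.imp (congrArg X) (congrArg X))
  · simp [hk]

end MvPolynomial

/-- The ideal `(x₁x₂, x₃x₄)` as an intersection of four linear primes. -/
theorem span_mul_mul_eq_inf :
    (Ideal.span {X 2 * X 3, X 0 * X 1} : Ideal (MvPolynomial (Fin 5) (ZMod 2))) =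
      (Ideal.span {X 0, X 2} ⊓ Ideal.span {X 0, X 3}) ⊓
        (Ideal.span {X 1, X 2} ⊓ Ideal.span {X 1, X 3}) := by
  have h0 : (Ideal.span {X 2 * X 3, X 0} : Ideal (MvPolynomial (Fin 5) (ZMod 2))) =
      Ideal.span {X 0, X 2} ⊓ Ideal.span {X 0, X 3} := by
    rw [Set.pair_comm]
    exact Ideal.span_pair_mul_eq_inf ((isPrime_span_pair_X 0 3).mem_span_pair_of_mul_mem
      (eval ![0, 0, 1, 0, 0]) (by simp) (by simp) (by simp))
  have h1 : (Ideal.span {X 2 * X 3, X 1} : Ideal (MvPolynomial (Fin 5) (ZMod 2))) =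
      Ideal.span {X 1, X 2} ⊓ Ideal.span {X 1, X 3} := by
    rw [Set.pair_comm]
    exact Ideal.span_pair_mul_eq_inf ((isPrime_span_pair_X 1 3).mem_span_pair_of_mul_mem
      (eval ![0, 0, 1, 0, 0]) (by simp) (by simp) (by simp))
  rw [← h0, ← h1]
  refine Ideal.span_pair_mul_eq_inf ?_
  rw [h1]
  exact Ideal.mem_inf_of_mul_mem_inf
    ((isPrime_span_pair_X 1 2).mem_span_pair_of_mul_mem
      (eval ![1, 0, 0, 0, 0]) (by simp) (by simp) (by simp))
    ((isPrime_span_pair_X 1 3).mem_span_pair_of_mul_mem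
      (eval ![1, 0, 0, 0, 0]) (by simp) (by simp) (by simp))

theorem isRadical_span_mul_mul :
    (Ideal.span {X 2 * X 3, X 0 * X 1} : Ideal (MvPolynomial (Fin 5) (ZMod 2))).IsRadical := by
  rw [span_mul_mul_eq_inf]
  exact ((isPrime_span_pair_X 0 2).isRadical.inf (isPrime_span_pair_X 0 3).isRadical).inf
    ((isPrime_span_pair_X 1 2).isRadical.inf (isPrime_span_pair_X 1 3).isRadical)

theorem mem_span_mul_mul_of_mul_sum_mem (b : MvPolynomial (Fin 5) (ZMod 2))
    (hb : b * (X 0 + X 1 + X 2 + X 3) ∈ Ideal.span {X 2 * X 3, X 0 * X 1}) :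
    b ∈ Ideal.span {X 2 * X 3, X 0 * X 1} := by
  rw [span_mul_mul_eq_inf] at hb ⊢
  refine Ideal.mem_inf_of_mul_mem_inf
    (Ideal.mem_inf_of_mul_mem_inf ?_ ?_) (Ideal.mem_inf_of_mul_mem_inf ?_ ?_) b hb
  · exact (isPrime_span_pair_X 0 2).mem_span_pair_of_mul_mem
      (eval ![0, 1, 0, 0, 0]) (by simp) (by simp) (by simp)
  · exact (isPrime_span_pair_X 0 3).mem_span_pair_of_mul_mem
      (eval ![0, 1, 0, 0, 0]) (by simp) (by simp) (by simp)
  · exact (isPrime_span_pair_X 1 2).mem_span_pair_of_mul_mem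
      (eval ![1, 0, 0, 0, 0]) (by simp) (by simp) (by simp)
  · exact (isPrime_span_pair_X 1 3).mem_span_pair_of_mul_mem
      (eval ![1, 0, 0, 0, 0]) (by simp) (by simp) (by simp)

theorem MvPolynomial.two_eq_zero_of_zmod_two {σ : Type*} : (2 : MvPolynomial σ (ZMod 2)) = 0 :=
  CharTwo.two_eq_zero

theorem isPrime_span_sum_add_X_zero :
    (Ideal.span {X 0 + X 1 + X 2 + X 3, X 2 + X 0} :
      Ideal (MvPolynomial (Fin 5) (ZMod 2))).IsPrime := by
  have h2 := two_eq_zero_of_zmod_two (σ := Fin 5)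
  refine isPrime_span_pair_of_aeval ![X 0, X 1, X 0, X 1, X 4] ?_ ?_ fun i => ?_
  · simp only [map_add, aeval_X]
    simp only [Matrix.cons_val]
    linear_combination (X 0 + X 1) * h2
  · simp only [map_add, aeval_X]
    simp only [Matrix.cons_val]
    linear_combination X 0 * h2
  · rw [Ideal.mem_span_pair]
    fin_cases i
    · exact ⟨0, 0, by simp⟩
    · exact ⟨0, 0, by simp⟩
    · exact ⟨0, 1, by simp only [Fin.reduceFinMk, Matrix.cons_val]; linear_combination X 0 * h2⟩
    · refine ⟨1, 1, ?_⟩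
      simp only [Fin.reduceFinMk, Matrix.cons_val]
      linear_combination (X 0 + X 1 + X 2) * h2
    · exact ⟨0, 0, by simp⟩

theorem isPrime_span_sum_add_X_one :
    (Ideal.span {X 0 + X 1 + X 2 + X 3, X 2 + X 1} :
      Ideal (MvPolynomial (Fin 5) (ZMod 2))).IsPrime := by
  have h2 := two_eq_zero_of_zmod_two (σ := Fin 5)
  refine isPrime_span_pair_of_aeval ![X 0, X 1, X 1, X 0, X 4] ?_ ?_ fun i => ?_
  · simp only [map_add, aeval_X]
    simp only [Matrix.cons_val]
    linear_combination (X 0 + X 1) * h2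
  · simp only [map_add, aeval_X]
    simp only [Matrix.cons_val]
    linear_combination X 1 * h2
  · rw [Ideal.mem_span_pair]
    fin_cases i
    · exact ⟨0, 0, by simp⟩
    · exact ⟨0, 0, by simp⟩
    · exact ⟨0, 1, by simp only [Fin.reduceFinMk, Matrix.cons_val]; linear_combination X 1 * h2⟩
    · refine ⟨1, 1, ?_⟩
      simp only [Fin.reduceFinMk, Matrix.cons_val]
      linear_combination (X 0 + X 1 + X 2) * h2
    · exact ⟨0, 0, by simp⟩

theorem isRadical_span_q0_sum :
    (Ideal.span {q0, X 0 + X 1 + X 2 + X 3}).IsRadical := by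
  have h2 := two_eq_zero_of_zmod_two (σ := Fin 5)
  have hq : q0 = (X 2 + X 0) * (X 2 + X 1) + X 2 * (X 0 + X 1 + X 2 + X 3) := by
    rw [q0]
    linear_combination (-(X 2 ^ 2 + X 0 * X 2 + X 1 * X 2)) * h2
  rw [hq, Ideal.span_pair_add_mul_right, Ideal.span_pair_comm,
    Ideal.span_pair_mul_eq_inf (isPrime_span_sum_add_X_one.mem_span_pair_of_mul_mem
      (eval ![1, 0, 0, 1, 0]) (by simp; decide) (by simp) (by simp))]
  exact isPrime_span_sum_add_X_zero.isRadical.inf isPrime_span_sum_add_X_one.isRadical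

theorem span_q0_mul : Ideal.span {q0, X 0 * X 1} = Ideal.span {X 2 * X 3, X 0 * X 1} := by
  rw [q0, show (X 0 * X 1 + X 2 * X 3 : MvPolynomial (Fin 5) (ZMod 2)) =
    X 2 * X 3 + 1 * (X 0 * X 1) by ring, Ideal.span_pair_add_mul_right]

theorem span_q0_q1 :
    Ideal.span {q0, q1} = Ideal.span {q0, (X 0 + X 1 + X 2 + X 3) * (X 0 * X 1)} := by
  have h2 := two_eq_zero_of_zmod_two (σ := Fin 5)
  have hq : q1 = (X 0 + X 1 + X 2 + X 3) * (X 0 * X 1) + (X 2 + X 3) * q0 := by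
    rw [q0, q1]
    linear_combination (-(X 0 * X 1 * (X 2 + X 3))) * h2
  rw [hq, Ideal.span_pair_add_mul_left]

/-- The ring `R = (ℤ/2)[x₁,x₂,x₃,x₄,w]/(q₀, q₁)` is reduced: it has no nonzero
nilpotent elements. -/
theorem stmt12 : IsReduced Rring := by
  refine (Ideal.isRadical_iff_quotient_reduced (Ideal.span {q0, q1})).1 ?_
  rw [span_q0_q1, Ideal.span_pair_mul_eq_inf]
  · rw [span_q0_mul]
    exact isRadical_span_q0_sum.inf isRadical_span_mul_mul
  · rw [span_q0_mul]
    exact mem_span_mul_mul_of_mul_sum_mem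
end
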